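/- arXiv:2506.03475 — 2 statements merged into one kernel-verified Lean document; each statement's English description precedes it below -/
import Mathlib

section
/- If τ lies on the positive imaginary axis, then g₃'(τ) ≠ 0; in fact g₂(τ)² − 18η₁(τ)g₃(τ) > 0, and moreover g₂(τ)² − 18t·η₁(τ)g₃(τ) > 0 for every t ∈ [0,1]. -/
open Complex Filter Asymptotics Set

noncomputable section

/-- q = e^{2πiτ} -/
def qq (τ : ℂ) : ℂ := Complex.exp (2 * (Real.pi : ℂ) * Complex.I * τ)

/-- divisor power sum σ_k(n) as a complex number -/
def sigmaC (k n : ℕ) : ℂ := ∑ d ∈ n.divisors, (d : ℂ) ^ k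

/-- normalized Eisenstein series E₂ -/
def E2 (τ : ℂ) : ℂ := 1 - 24 * ∑' n : ℕ, sigmaC 1 (n + 1) * qq τ ^ (n + 1)

/-- normalized Eisenstein series E₄ -/
def E4 (τ : ℂ) : ℂ := 1 + 240 * ∑' n : ℕ, sigmaC 3 (n + 1) * qq τ ^ (n + 1)

/-- normalized Eisenstein series E₆ -/
def E6 (τ : ℂ) : ℂ := 1 - 504 * ∑' n : ℕ, sigmaC 5 (n + 1) * qq τ ^ (n + 1)

/-- elliptic invariant g₂ -/
def g2 (τ : ℂ) : ℂ := (4 * (Real.pi : ℂ) ^ 4 / 3) * E4 τ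

/-- elliptic invariant g₃ -/
def g3 (τ : ℂ) : ℂ := (8 * (Real.pi : ℂ) ^ 6 / 27) * E6 τ

/-- quasi-period η₁ -/
def eta1 (τ : ℂ) : ℂ := ((Real.pi : ℂ) ^ 2 / 3) * E2 τ

/-- quasi-period η₂ (Legendre relation) -/
def eta2 (τ : ℂ) : ℂ := τ * eta1 τ - 2 * (Real.pi : ℂ) * Complex.I

/-- the function h = g₂² − 18η₁g₃ -/
def hh (τ : ℂ) : ℂ := g2 τ ^ 2 - 18 * eta1 τ * g3 τ

/-- the family f_C -/
def f (C τ : ℂ) : ℂ := (C - τ) * g2 τ ^ 2 - 18 * (C * eta1 τ - eta2 τ) * g3 τ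

end

/-- the power series with coefficients the divisor power sums -/
noncomputable def phiS (k : ℕ) (x : ℂ) : ℂ := ∑' n : ℕ, sigmaC k (n + 1) * x ^ (n + 1)

lemma sigmaC_eq (k n : ℕ) : sigmaC k n = ((ArithmeticFunction.sigma k n : ℕ) : ℂ) := by
  simp [sigmaC, ArithmeticFunction.sigma_apply]

lemma sigmaC_norm_le (k n : ℕ) : ‖sigmaC k n‖ ≤ (n : ℝ) ^ (k + 1) := by
  rw [sigmaC_eq, Complex.norm_natCast]
  exact_mod_cast ArithmeticFunction.sigma_le_pow_succ k n

lemma summable_bound (k : ℕ) (r : ℝ) (h0 : 0 ≤ r) (h1 : r < 1) :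
    Summable (fun n : ℕ => ((n + 1 : ℕ) : ℝ) ^ (k + 1) * r ^ (n + 1)) :=
  (summable_nat_add_iff (f := fun n : ℕ => (n : ℝ) ^ (k + 1) * r ^ n) 1).mpr
    (summable_pow_mul_geometric_of_norm_lt_one (k + 1)
      (by rwa [Real.norm_of_nonneg h0]))

lemma term_bound (k : ℕ) (r : ℝ) (n : ℕ) (w : ℂ) (hw : w ∈ Metric.ball (0 : ℂ) r) :
    ‖sigmaC k (n + 1) * w ^ (n + 1)‖ ≤ ((n + 1 : ℕ) : ℝ) ^ (k + 1) * r ^ (n + 1) := by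
  have : ‖w‖ ≤ r := by simpa using (mem_ball_zero_iff.mp hw).le
  rw [norm_mul, norm_pow]
  gcongr
  exact sigmaC_norm_le k (n + 1)

lemma exists_rad (x : ℂ) (hx : ‖x‖ < 1) : ∃ r : ℝ, 0 ≤ r ∧ r < 1 ∧ x ∈ Metric.ball (0 : ℂ) r := by
  obtain ⟨r, h1, h2⟩ := exists_between hx
  exact ⟨r, (norm_nonneg x).trans h1.le, h2, mem_ball_zero_iff.mpr h1⟩

lemma phiS_summable (k : ℕ) (x : ℂ) (hx : ‖x‖ < 1) :
    Summable (fun n : ℕ => sigmaC k (n + 1) * x ^ (n + 1)) := by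
  obtain ⟨r, h0, h1, h2⟩ := exists_rad x hx
  exact Summable.of_norm_bounded (summable_bound k r h0 h1) (fun n => term_bound k r n x h2)

lemma phiS_diffOn (k : ℕ) : DifferentiableOn ℂ (phiS k) (Metric.ball 0 1) := by
  intro x hx
  obtain ⟨r, h0, h1, h2⟩ := exists_rad x (mem_ball_zero_iff.mp hx)
  have := Complex.differentiableOn_tsum_of_summable_norm (summable_bound k r h0 h1)
    (F := fun n (w : ℂ) => sigmaC k (n + 1) * w ^ (n + 1)) (U := Metric.ball (0 : ℂ) r)
    (fun i => by fun_prop) Metric.isOpen_ball (fun i w hw => term_bound k r i w hw)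
  exact (this.differentiableAt (Metric.isOpen_ball.mem_nhds h2)).differentiableWithinAt

lemma phiS_deriv_hasSum (k : ℕ) (x : ℂ) (hx : ‖x‖ < 1) :
    HasSum (fun n : ℕ => sigmaC k (n + 1) * (((n + 1 : ℕ) : ℂ) * x ^ n)) (deriv (phiS k) x) := by
  obtain ⟨r, h0, h1, h2⟩ := exists_rad x hx
  have := Complex.hasSum_deriv_of_summable_norm (summable_bound k r h0 h1)
    (F := fun n (w : ℂ) => sigmaC k (n + 1) * w ^ (n + 1)) (U := Metric.ball (0 : ℂ) r)
    (fun i => by fun_prop) Metric.isOpen_ball (fun i w hw => term_bound k r i w hw) h2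
  convert! this using 2 with n
  simp

lemma phiS_zero (k : ℕ) : phiS k 0 = 0 := by simp [phiS]

/-- real value of the power series -/
lemma phiS_real (k : ℕ) (q : ℝ) (h0 : 0 < q) (h1 : q < 1) :
    ∃ r : ℝ, 0 < r ∧ phiS k (q : ℂ) = r := by
  have hs := phiS_summable k (q : ℂ) (by simpa [abs_of_pos h0] using h1)
  have e : (fun n : ℕ => sigmaC k (n + 1) * (q : ℂ) ^ (n + 1)) =
      fun n : ℕ => (((ArithmeticFunction.sigma k (n + 1) : ℕ) * q ^ (n + 1) : ℝ) : ℂ) := by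
    ext n; rw [sigmaC_eq]; push_cast; rfl
  refine ⟨∑' n : ℕ, ((ArithmeticFunction.sigma k (n + 1) : ℕ) * q ^ (n + 1) : ℝ), ?_, ?_⟩
  · rw [e, Complex.summable_ofReal] at hs
    refine hs.tsum_pos (fun n => by positivity) 0 ?_
    simp [h0]
  · rw [phiS, e, Complex.ofReal_tsum]

lemma phiS_deriv_real (k : ℕ) (q : ℝ) (h0 : 0 < q) (h1 : q < 1) :
    ∃ r : ℝ, 0 < r ∧ deriv (phiS k) (q : ℂ) = r := by
  have hs := phiS_deriv_hasSum k (q : ℂ) (by simpa [abs_of_pos h0] using h1)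
  have e : (fun n : ℕ => sigmaC k (n + 1) * (((n + 1 : ℕ) : ℂ) * (q : ℂ) ^ n)) =
      fun n : ℕ => (((ArithmeticFunction.sigma k (n + 1) : ℕ) *
        (((n + 1 : ℕ) : ℝ) * q ^ n) : ℝ) : ℂ) := by
    ext n; rw [sigmaC_eq]; push_cast; rfl
  rw [e] at hs
  refine ⟨∑' n : ℕ, ((ArithmeticFunction.sigma k (n + 1) : ℕ) *
        (((n + 1 : ℕ) : ℝ) * q ^ n) : ℝ), ?_, ?_⟩
  · have hs' := Complex.summable_ofReal.mp hs.summable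
    refine hs'.tsum_pos (fun n => by positivity) 0 ?_
    simp
  · rw [← hs.tsum_eq, Complex.ofReal_tsum]

lemma E2_phi (τ : ℂ) : E2 τ = 1 - 24 * phiS 1 (qq τ) := rfl
lemma E4_phi (τ : ℂ) : E4 τ = 1 + 240 * phiS 3 (qq τ) := rfl
lemma E6_phi (τ : ℂ) : E6 τ = 1 - 504 * phiS 5 (qq τ) := rfl

lemma qq_norm_lt (z : UpperHalfPlane) : ‖qq z‖ < 1 :=
  UpperHalfPlane.norm_exp_two_pi_I_lt_one z

lemma qq_hasDerivAt (τ : ℂ) : HasDerivAt qq (2 * (Real.pi : ℂ) * Complex.I * qq τ) τ := by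
  have := ((hasDerivAt_id τ).const_mul (2 * (Real.pi : ℂ) * Complex.I)).cexp
  convert! this using 1
  simp [qq]; ring

lemma E6_hasDerivAt (z : UpperHalfPlane) : HasDerivAt E6
    (-504 * (deriv (phiS 5) (qq z) * (2 * (Real.pi : ℂ) * Complex.I * qq z))) (z : ℂ) := by
  have hd : DifferentiableAt ℂ (phiS 5) (qq z) :=
    (phiS_diffOn 5).differentiableAt (Metric.isOpen_ball.mem_nhds
      (mem_ball_zero_iff.mpr (qq_norm_lt z)))
  have := ((hd.hasDerivAt.comp (z : ℂ) (qq_hasDerivAt z)).const_mul 504).const_sub 1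
  convert! this using 1
  ring

lemma tsum_pnat_phi (k : ℕ) (z : UpperHalfPlane) :
    ∑' n : ℕ+, ((ArithmeticFunction.sigma k n : ℕ) : ℂ) *
      Complex.exp (2 * Real.pi * Complex.I * z) ^ (n : ℕ) = phiS k (qq z) := by
  rw [tsum_pnat_eq_tsum_succ (f := fun n : ℕ => ((ArithmeticFunction.sigma k n : ℕ) : ℂ) *
      Complex.exp (2 * Real.pi * Complex.I * z) ^ n)]
  simp [phiS, sigmaC_eq, qq]

lemma E2_match (z : UpperHalfPlane) : EisensteinSeries.E2 z = 1 - 24 * phiS 1 (qq z) := by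
  rw [EisensteinSeries.E2_eq_tsum_cexp, ← tsum_pnat_phi]

lemma E4_match (z : UpperHalfPlane) :
    (ModularForm.E (k := 4) (by norm_num)) z = 1 + 240 * phiS 3 (qq z) := by
  rw [EisensteinSeries.q_expansion_bernoulli _ ⟨2, rfl⟩, ← tsum_pnat_phi]
  norm_num [show bernoulli 4 = -1 / 30 by decide +kernel]

lemma E6_match (z : UpperHalfPlane) :
    (ModularForm.E (k := 6) (by norm_num)) z = 1 - 504 * phiS 5 (qq z) := by
  rw [EisensteinSeries.q_expansion_bernoulli _ ⟨3, rfl⟩, ← tsum_pnat_phi]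
  norm_num [show bernoulli 6 = 1 / 42 by decide +kernel]

open scoped Manifold MatrixGroups ModularForm in
/-- the weight 8 combination that Ramanujan says vanishes -/
noncomputable def ramF : UpperHalfPlane → ℂ :=
  Derivative.serreDerivative ((6 : ℤ) : ℂ) ModularForm.E₆ +
    (1 / 2 : ℂ) • ((ModularForm.E₄ : UpperHalfPlane → ℂ) * (ModularForm.E₄ : UpperHalfPlane → ℂ))

lemma ramF_apply (z : UpperHalfPlane) : ramF z =
    -504 * (deriv (phiS 5) (qq z) * qq z) -
      1 / 2 * (1 - 24 * phiS 1 (qq z)) * (1 - 504 * phiS 5 (qq z)) +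
      1 / 2 * (1 + 240 * phiS 3 (qq z)) ^ 2 := by
  have hD : Derivative.normalizedDerivOfComplex ModularForm.E₆ z =
      -504 * (deriv (phiS 5) (qq z) * qq z) := by
    rw [Derivative.normalizedDerivOfComplex]
    have : ((ModularForm.E₆ : UpperHalfPlane → ℂ) ∘ UpperHalfPlane.ofComplex)
        =ᶠ[nhds (z : ℂ)] E6 := by
      filter_upwards [UpperHalfPlane.isOpen_upperHalfPlaneSet.mem_nhds z.im_pos] with w hw
      rw [Function.comp_apply, UpperHalfPlane.ofComplex_apply_of_im_pos hw]
      exact E6_match _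
    rw [this.deriv_eq, (E6_hasDerivAt z).deriv]
    have := Real.pi_ne_zero
    have : (Real.pi : ℂ) ≠ 0 := by exact_mod_cast this
    field_simp [Complex.I_ne_zero]
  have h4 := E4_match z
  have h6 := E6_match z
  simp only [ramF, Pi.add_apply, Pi.smul_apply, Pi.mul_apply, Derivative.serreDerivative, hD,
    E2_match, ModularForm.E₄, ModularForm.E₆, smul_eq_mul]
  rw [h4, h6]
  push_cast
  ring

lemma ramF_slash (γ : Matrix.SpecialLinearGroup (Fin 2) ℤ) :
    SlashAction.map (8 : ℤ) γ ramF = ramF := by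
  have hγ : (γ : Matrix.GeneralLinearGroup (Fin 2) ℝ) ∈
    (Matrix.SpecialLinearGroup.mapGL ℝ : Matrix.SpecialLinearGroup (Fin 2) ℤ →* _).range := ⟨γ, rfl⟩
  have h4 : SlashAction.map (4 : ℤ) γ (ModularForm.E₄ : UpperHalfPlane → ℂ) = ModularForm.E₄ :=
    SlashInvariantForm.slash_action_eqn ModularForm.E₄ _ hγ
  have h6 : SlashAction.map (6 : ℤ) γ (ModularForm.E₆ : UpperHalfPlane → ℂ) = ModularForm.E₆ :=
    SlashInvariantForm.slash_action_eqn ModularForm.E₆ _ hγ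
  have h8 : SlashAction.map (8 : ℤ) γ ((ModularForm.E₄ : UpperHalfPlane → ℂ) * ModularForm.E₄)
      = (ModularForm.E₄ : UpperHalfPlane → ℂ) * ModularForm.E₄ := by
    have := ModularForm.mul_slash_SL2 4 4 γ (ModularForm.E₄ : UpperHalfPlane → ℂ) ModularForm.E₄
    rw [h4] at this
    exact this
  have hs := Derivative.serreDerivative_slash_invariant (k := 6) ModularForm.E₆.holo' (γ := γ) h6
  rw [ramF, SlashAction.add_slash, ModularForm.SL_smul_slash, h8]
  congr 1

lemma qq_tendsto : Tendsto (fun z : UpperHalfPlane => qq z) UpperHalfPlane.atImInfty (nhds 0) := by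
  have := UpperHalfPlane.qParam_tendsto_atImInfty (h := 1) one_pos
  refine this.congr (fun z => ?_)
  simp [Function.Periodic.qParam, qq]

lemma phiS_an (k : ℕ) : AnalyticAt ℂ (phiS k) 0 :=
  (phiS_diffOn k).analyticAt (Metric.isOpen_ball.mem_nhds (by simp))

lemma ramF_zero_at : UpperHalfPlane.IsZeroAtImInfty ramF := by
  have hc : ContinuousAt (fun x : ℂ => -504 * (deriv (phiS 5) x * x) -
      1 / 2 * (1 - 24 * phiS 1 x) * (1 - 504 * phiS 5 x) +
      1 / 2 * (1 + 240 * phiS 3 x) ^ 2) 0 := by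
    have h1 := (phiS_an 1).continuousAt
    have h3 := (phiS_an 3).continuousAt
    have h5 := (phiS_an 5).continuousAt
    have h5' := (phiS_an 5).deriv.continuousAt
    fun_prop
  have := hc.tendsto.comp qq_tendsto
  simp only [phiS_zero] at this
  have h2 : Tendsto ramF UpperHalfPlane.atImInfty (nhds 0) := by
    have h3 := this.congr (fun z => (ramF_apply z).symm)
    norm_num at h3
    exact h3
  exact h2

open scoped MatrixGroups in
/-- the combination as a cusp form -/
noncomputable def ramCusp : CuspForm 𝒮ℒ 8 where
  toFun := ramF
  slash_action_eq' A hA := by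
    obtain ⟨A, rfl⟩ := hA
    exact ramF_slash A
  holo' := by
    refine MDifferentiable.add (Derivative.serreDerivative_mdifferentiable _ ModularForm.E₆.holo') ?_
    exact MDifferentiable.const_smul _ (MDifferentiable.mul ModularForm.E₄.holo' ModularForm.E₄.holo')
  zero_at_cusps' hc := by
    rw [Subgroup.IsArithmetic.isCusp_iff_isCusp_SL2Z] at hc
    rw [OnePoint.isZeroAt_iff_forall_SL2Z hc]
    intro γ _
    have := ramF_slash γ
    rw [this]
    exact ramF_zero_at

lemma ramF_eq_zero (z : UpperHalfPlane) : ramF z = 0 := by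
  have h : ramCusp = 0 := rank_zero_iff_forall_zero.mp
    (CuspForm.rank_eq_zero_of_weight_lt_twelve (by norm_num)) ramCusp
  exact DFunLike.congr_fun h z

theorem positivity_on_imaginary_axis (b : ℝ) (hb : 0 < b) :
    deriv g3 (Complex.I * b) ≠ 0 ∧
    (∃ r : ℝ, 0 < r ∧ g2 (Complex.I * b) ^ 2 - 18 * eta1 (Complex.I * b) * g3 (Complex.I * b) = r) ∧
    (∀ t ∈ Set.Icc (0 : ℝ) 1, ∃ r : ℝ, 0 < r ∧
      g2 (Complex.I * b) ^ 2 - 18 * (t : ℂ) * eta1 (Complex.I * b) * g3 (Complex.I * b) = r) := by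
  obtain ⟨z, hz⟩ : ∃ z : UpperHalfPlane, (z : ℂ) = Complex.I * b :=
    ⟨⟨Complex.I * b, by simpa using hb⟩, rfl⟩
  set q : ℝ := Real.exp (-(2 * Real.pi * b)) with hq
  have hq0 : 0 < q := Real.exp_pos _
  have hq1 : q < 1 := by
    rw [hq, Real.exp_lt_one_iff]
    have := Real.pi_pos
    have : 0 < 2 * Real.pi * b := by positivity
    linarith
  have hqq : qq (Complex.I * b) = (q : ℂ) := by
    rw [qq, hq, Complex.ofReal_exp]
    congr 1
    push_cast
    linear_combination (2 * (Real.pi : ℂ) * b) * Complex.I_sq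
  obtain ⟨r1, -, hr1⟩ := phiS_real 1 q hq0 hq1
  obtain ⟨r3, h3, hr3⟩ := phiS_real 3 q hq0 hq1
  obtain ⟨r5, -, hr5⟩ := phiS_real 5 q hq0 hq1
  obtain ⟨d, hd, hrd⟩ := phiS_deriv_real 5 q hq0 hq1
  have hram := ramF_eq_zero z
  rw [ramF_apply, hz, hqq, hr1, hr3, hr5, hrd] at hram
  have hpi := Real.pi_pos
  have key : ∀ t ∈ Set.Icc (0 : ℝ) 1, ∃ r : ℝ, 0 < r ∧
      g2 (Complex.I * b) ^ 2 - 18 * (t : ℂ) * eta1 (Complex.I * b) * g3 (Complex.I * b) = r := by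
    rintro t ⟨ht0, ht1⟩
    refine ⟨16 * Real.pi ^ 8 / 9 * ((1 - t) * (1 + 240 * r3) ^ 2 + t * (1008 * (d * q))), ?_, ?_⟩
    · have hA : 0 < (1 + 240 * r3) ^ 2 := by positivity
      have hB : 0 < 1008 * (d * q) := by positivity
      have : 0 < (1 - t) * (1 + 240 * r3) ^ 2 + t * (1008 * (d * q)) := by
        rcases ht0.eq_or_lt with h | h
        · subst h; simpa using hA
        · have h1 : 0 ≤ (1 - t) * (1 + 240 * r3) ^ 2 := mul_nonneg (by linarith) hA.le
          have h2 : 0 < t * (1008 * (d * q)) := mul_pos h hB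
          linarith
      positivity
    · rw [g2, eta1, g3, E2_phi, E4_phi, E6_phi, hqq, hr1, hr3, hr5]
      push_cast
      linear_combination (32 * (Real.pi : ℂ) ^ 8 / 9 * t) * hram
  refine ⟨?_, ?_, key⟩
  · have hder := (E6_hasDerivAt z).const_mul (8 * (Real.pi : ℂ) ^ 6 / 27)
    rw [hz, hqq, hrd] at hder
    have : deriv g3 (Complex.I * b) = _ := hder.deriv
    rw [this]
    have h1 : (Real.pi : ℂ) ≠ 0 := by exact_mod_cast hpi.ne'
    have h2 : (d : ℂ) ≠ 0 := by exact_mod_cast hd.ne'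
    have h3 : (q : ℂ) ≠ 0 := by exact_mod_cast hq0.ne'
    simp [h1, h2, h3]
  · simpa using key 1 (by simp)
end

section
/- The function g₃'(τ) (equivalently g₂(τ)² − 18η₁(τ)g₃(τ)) has at least one zero τ∞ = 1/2 + ib∞ on the segment {1/2 + ib : 1/2 < b < √3/2}. -/
open Complex Filter Asymptotics Set

lemma aux_sigmaC (k n : ℕ) : sigmaC k n = (ArithmeticFunction.sigma k n : ℂ) := by
  simp [sigmaC, ArithmeticFunction.sigma_apply]

lemma aux_tsum (k : ℕ) (z : UpperHalfPlane) :
    ∑' n : ℕ, sigmaC k (n + 1) * qq z ^ (n + 1) =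
      ∑' n : ℕ+, (ArithmeticFunction.sigma k n : ℂ) *
        Complex.exp (2 * Real.pi * Complex.I * z) ^ (n : ℕ) := by
  rw [tsum_pnat_eq_tsum_succ (f := fun n : ℕ => (ArithmeticFunction.sigma k n : ℂ) *
        Complex.exp (2 * Real.pi * Complex.I * z) ^ n)]
  simp [aux_sigmaC, qq]

lemma aux_E2 (z : UpperHalfPlane) : E2 z = EisensteinSeries.E2 z := by
  rw [EisensteinSeries.E2_eq_tsum_cexp, E2, aux_tsum]

lemma aux_E4 (z : UpperHalfPlane) : E4 z = ModularForm.E₄ z := by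
  rw [EisensteinSeries.q_expansion_bernoulli _ (by decide), E4, aux_tsum]
  have : bernoulli 4 = -1 / 30 := by decide +kernel
  rw [this]
  norm_num

lemma aux_E6 (z : UpperHalfPlane) : E6 z = ModularForm.E₆ z := by
  rw [EisensteinSeries.q_expansion_bernoulli _ (by decide), E6, aux_tsum]
  have : bernoulli 6 = 1 / 42 := by decide +kernel
  rw [this]
  norm_num

lemma aux_S (z : UpperHalfPlane) : ((ModularGroup.S • z : UpperHalfPlane) : ℂ) = -1 / z := by
  rw [UpperHalfPlane.modular_S_smul]
  simp [neg_div, inv_neg]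

open scoped MatrixGroups ModularForm in
lemma aux_slash_4 (γ : SL(2, ℤ)) : (ModularForm.E₄ : UpperHalfPlane → ℂ) ∣[(4 : ℤ)] γ =
    ModularForm.E₄ :=
  SlashInvariantForm.slash_action_eqn ModularForm.E₄ _ ⟨γ, rfl⟩

open scoped MatrixGroups ModularForm in
lemma aux_slash_6 (γ : SL(2, ℤ)) : (ModularForm.E₆ : UpperHalfPlane → ℂ) ∣[(6 : ℤ)] γ =
    ModularForm.E₆ :=
  SlashInvariantForm.slash_action_eqn ModularForm.E₆ _ ⟨γ, rfl⟩

lemma aux_E4_S (z : UpperHalfPlane) : E4 (-1 / z) = (z : ℂ) ^ 4 * E4 z := by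
  rw [← aux_S, aux_E4, aux_E4]
  have h := congrFun (aux_slash_4 ModularGroup.S) z
  rw [ModularForm.SL_slash_apply, ModularGroup.denom_S] at h
  rw [← h]
  have hz := z.ne_zero
  rw [zpow_neg]
  norm_cast
  field_simp

lemma aux_E6_S (z : UpperHalfPlane) : E6 (-1 / z) = (z : ℂ) ^ 6 * E6 z := by
  rw [← aux_S, aux_E6, aux_E6]
  have h := congrFun (aux_slash_6 ModularGroup.S) z
  rw [ModularForm.SL_slash_apply, ModularGroup.denom_S] at h
  rw [← h]
  have hz := z.ne_zero
  rw [zpow_neg]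
  norm_cast
  field_simp

lemma aux_E2_S (z : UpperHalfPlane) :
    E2 z = ((z : ℂ) ^ 2)⁻¹ * E2 (-1 / z) + 6 * Complex.I / (Real.pi * z) := by
  rw [← aux_S, aux_E2, aux_E2]
  have h := EisensteinSeries.G2_S_transform z
  simp only [EisensteinSeries.E2, Pi.smul_apply, smul_eq_mul]
  rw [h, riemannZeta_two]
  have hz := z.ne_zero
  have hp : (Real.pi : ℂ) ≠ 0 := by exact_mod_cast Real.pi_ne_zero
  field_simp
  ring

lemma aux_qq_one (z : ℂ) : qq (z + 1) = qq z := by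
  unfold qq
  rw [mul_add, mul_one, Complex.exp_periodic]

lemma aux_E2_T (z : ℂ) : E2 (z + 1) = E2 z := by simp only [E2, aux_qq_one]
lemma aux_E4_T (z : ℂ) : E4 (z + 1) = E4 z := by simp only [E4, aux_qq_one]
lemma aux_E6_T (z : ℂ) : E6 (z + 1) = E6 z := by simp only [E6, aux_qq_one]

lemma aux_disc (z : UpperHalfPlane) : E4 z ^ 3 - E6 z ^ 2 ≠ 0 := by
  have h := ModularForm.discriminant_eq_E₄_cube_sub_E₆_sq z
  have h2 := ModularForm.discriminant_ne_zero z
  rw [aux_E4, aux_E6]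
  intro h3
  rw [h3] at h
  simp [h] at h2

lemma aux_summable (k : ℕ) {r : ℝ} (h0 : 0 ≤ r) (h1 : r < 1) :
    Summable fun n : ℕ => ‖sigmaC k (n + 1)‖ * r ^ n := by
  have h2 : Summable fun n : ℕ => ((n + 1 : ℕ) : ℝ) ^ (k + 1) * r ^ (n + 1) :=
    (summable_nat_add_iff (f := fun n : ℕ => (n : ℝ) ^ (k + 1) * r ^ n) 1).mpr (summable_pow_mul_geometric_of_norm_lt_one (k + 1)
      (by rwa [Real.norm_of_nonneg h0]))
  rcases h0.eq_or_lt with rfl | h0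
  · refine summable_of_ne_finset_zero (s := {0}) ?_
    intro b hb
    have : b ≠ 0 := by simpa using hb
    simp [this]
  refine Summable.of_nonneg_of_le (fun n => by positivity) (fun n => ?_) (h2.mul_left r⁻¹)
  have : ‖sigmaC k (n + 1)‖ ≤ ((n + 1 : ℕ) : ℝ) ^ (k + 1) := by
    rw [aux_sigmaC, Complex.norm_natCast]
    exact_mod_cast ArithmeticFunction.sigma_le_pow_succ k (n + 1)
  calc _ ≤ ((n + 1 : ℕ) : ℝ) ^ (k + 1) * r ^ n := by gcongr
    _ = _ := by field_simp; ring

/-- The tail is small near the cusp. -/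
lemma aux_tail (k : ℕ) (c : ℂ) : ∃ C : ℝ, 0 ≤ C ∧ ∀ z : ℂ, 1 ≤ z.im →
    ‖c * ∑' n : ℕ, sigmaC k (n + 1) * qq z ^ (n + 1)‖ ≤ C * Real.exp (-2 * Real.pi * z.im) := by
  set r : ℝ := Real.exp (-2 * Real.pi) with hr
  have hr1 : r < 1 := by rw [hr, Real.exp_lt_one_iff]; nlinarith [Real.pi_pos]
  have hs := aux_summable k (Real.exp_nonneg (-2 * Real.pi)) hr1
  refine ⟨‖c‖ * ∑' n : ℕ, ‖sigmaC k (n + 1)‖ * r ^ n,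
    mul_nonneg (norm_nonneg _) (tsum_nonneg fun n => by positivity), fun z hz => ?_⟩
  have hq : ‖qq z‖ = Real.exp (-2 * Real.pi * z.im) := by
    rw [qq, Complex.norm_exp]; congr 1; simp
  have hqr : ‖qq z‖ ≤ r := by
    rw [hq, hr, Real.exp_le_exp]; nlinarith [Real.pi_pos]
  rw [norm_mul, mul_assoc, ← hq, ← tsum_mul_right]
  gcongr
  refine tsum_of_norm_bounded (hs.mul_right ‖qq z‖).hasSum fun n => ?_
  rw [norm_mul, norm_pow, pow_succ, ← mul_assoc]
  gcongr

lemma aux_comp_E6 {z : ℂ} (hz : 0 < z.im) :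
    (ModularForm.E₆ ∘ UpperHalfPlane.ofComplex) z = E6 z := by
  rw [Function.comp_apply, UpperHalfPlane.ofComplex_apply_of_im_pos hz, ← aux_E6]

lemma aux_eventuallyEq_E6 {z : ℂ} (hz : 0 < z.im) :
    (ModularForm.E₆ ∘ UpperHalfPlane.ofComplex) =ᶠ[nhds z] E6 := by
  filter_upwards [(isOpen_lt continuous_const Complex.continuous_im).mem_nhds hz] with w hw
  exact aux_comp_E6 hw

lemma aux_diff {F : UpperHalfPlane → ℂ} {G : ℂ → ℂ}
    (hF : MDifferentiable (modelWithCornersSelf ℂ ℂ) (modelWithCornersSelf ℂ ℂ) F)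
    (h : ∀ z : UpperHalfPlane, G z = F z) {z : ℂ} (hz : 0 < z.im) : DifferentiableAt ℂ G z := by
  rw [UpperHalfPlane.mdifferentiable_iff] at hF
  have ho : {w : ℂ | 0 < w.im} ∈ nhds z :=
    (isOpen_lt continuous_const Complex.continuous_im).mem_nhds hz
  refine (hF.differentiableAt ho).congr_of_eventuallyEq ?_
  filter_upwards [ho] with w hw
  rw [Function.comp_apply, UpperHalfPlane.ofComplex_apply_of_im_pos hw, ← h]

lemma aux_diff_E2 {z : ℂ} (hz : 0 < z.im) : DifferentiableAt ℂ E2 z :=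
  aux_diff E2_mdifferentiable aux_E2 hz
lemma aux_diff_E4 {z : ℂ} (hz : 0 < z.im) : DifferentiableAt ℂ E4 z :=
  aux_diff ModularForm.E₄.holo' aux_E4 hz
lemma aux_diff_E6 {z : ℂ} (hz : 0 < z.im) : DifferentiableAt ℂ E6 z :=
  aux_diff ModularForm.E₆.holo' aux_E6 hz

lemma aux_exp_tendsto (C s : ℝ) : Filter.Tendsto
    (fun z : UpperHalfPlane => C * Real.exp (-2 * Real.pi * (z.im - s)))
    UpperHalfPlane.atImInfty (nhds 0) := by
  have h1 : Filter.Tendsto (fun x : ℝ => -2 * Real.pi * (x - s)) Filter.atTop Filter.atBot :=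
    (Filter.tendsto_atTop_add_const_right _ (-s) Filter.tendsto_id).const_mul_atTop_of_neg
      (by nlinarith [Real.pi_pos])
  have h2 := ((Real.tendsto_exp_atBot.comp h1).const_mul C).comp
    (Filter.tendsto_comap (f := UpperHalfPlane.im) (x := Filter.atTop))
  rw [mul_zero] at h2
  exact h2

lemma aux_im_ge (a : ℝ) : ∀ᶠ z : UpperHalfPlane in UpperHalfPlane.atImInfty, a ≤ z.im :=
  (Filter.tendsto_comap (f := UpperHalfPlane.im) (x := Filter.atTop)).eventually
    (Filter.eventually_ge_atTop a)

lemma aux_tendsto_tail (k : ℕ) (c : ℂ) : Filter.Tendsto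
    (fun z : UpperHalfPlane => c * ∑' n : ℕ, sigmaC k (n + 1) * qq z ^ (n + 1))
    UpperHalfPlane.atImInfty (nhds 0) := by
  obtain ⟨C, _, hC⟩ := aux_tail k c
  refine squeeze_zero_norm' ?_ (aux_exp_tendsto C 0)
  filter_upwards [aux_im_ge 1] with z hz
  simpa using hC z hz

lemma aux_lim_E2 : Filter.Tendsto (fun z : UpperHalfPlane => E2 z)
    UpperHalfPlane.atImInfty (nhds 1) := by
  simpa [E2] using (aux_tendsto_tail 1 24).const_sub 1
lemma aux_lim_E4 : Filter.Tendsto (fun z : UpperHalfPlane => E4 z)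
    UpperHalfPlane.atImInfty (nhds 1) := by
  simpa [E4] using (aux_tendsto_tail 3 240).const_add 1
lemma aux_lim_E6 : Filter.Tendsto (fun z : UpperHalfPlane => E6 z)
    UpperHalfPlane.atImInfty (nhds 1) := by
  simpa [E6] using (aux_tendsto_tail 5 504).const_sub 1

lemma aux_lim_deriv : Filter.Tendsto (fun z : UpperHalfPlane => deriv E6 z)
    UpperHalfPlane.atImInfty (nhds 0) := by
  obtain ⟨C, hC0, hC⟩ := aux_tail 5 504
  refine squeeze_zero_norm' ?_ (aux_exp_tendsto C 1)
  filter_upwards [aux_im_ge 2] with z hz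
  have hz' : 2 ≤ (z : ℂ).im := hz
  have him : ∀ w ∈ Metric.closedBall (z : ℂ) 1, (z : ℂ).im - 1 ≤ w.im := by
    intro w hw
    have h1 := (Complex.abs_im_le_norm (w - z)).trans (by simpa [dist_eq_norm] using hw)
    rw [Complex.sub_im] at h1
    linarith [(abs_le.mp h1).1]
  have hd : DiffContOnCl ℂ (fun w => E6 w - 1) (Metric.ball (z : ℂ) 1) := by
    apply DifferentiableOn.diffContOnCl
    rw [closure_ball _ one_ne_zero]
    intro w hw
    exact ((aux_diff_E6 (by linarith [him w hw])).sub_const 1).differentiableWithinAt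
  have := Complex.norm_deriv_le_of_forall_mem_sphere_norm_le one_pos hd
    (C := C * Real.exp (-2 * Real.pi * (z.im - 1))) ?_
  · simpa using this
  · intro w hw
    have h1 := him w (Metric.sphere_subset_closedBall hw)
    have h2 : ‖E6 w - 1‖ ≤ C * Real.exp (-2 * Real.pi * w.im) := by
      simpa [E6] using hC w (by linarith)
    refine h2.trans ?_
    have : (z : ℂ).im = z.im := rfl
    refine mul_le_mul_of_nonneg_left (Real.exp_le_exp.mpr ?_) hC0
    nlinarith [Real.pi_pos]

/-- The weight 8 function which vanishes by Ramanujan's identity. -/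
noncomputable def auxF : UpperHalfPlane → ℂ :=
  Derivative.serreDerivative ((6 : ℤ) : ℂ) ModularForm.E₆ +
    (1 / 2 : ℂ) • ((ModularForm.E₄ : UpperHalfPlane → ℂ) * ModularForm.E₄)

open scoped MatrixGroups ModularForm in
lemma auxF_slash (γ : SL(2, ℤ)) : auxF ∣[(8 : ℤ)] γ = auxF := by
  have h1 := Derivative.serreDerivative_slash_invariant (k := 6) ModularForm.E₆.holo'
    (aux_slash_6 γ)
  have h2 := ModularForm.mul_slash_SL2 4 4 γ ModularForm.E₄ ModularForm.E₄
  rw [aux_slash_4] at h2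
  norm_num at h2
  rw [show (6 : ℤ) + 2 = 8 by norm_num] at h1
  change Derivative.serreDerivative ((6 : ℤ) : ℂ) ModularForm.E₆ ∣[(8 : ℤ)] γ =
    Derivative.serreDerivative ((6 : ℤ) : ℂ) ModularForm.E₆ at h1
  rw [auxF, SlashAction.add_slash, ModularForm.SL_smul_slash, h2, h1]

lemma auxF_apply (z : UpperHalfPlane) : auxF z =
    (2 * Real.pi * Complex.I)⁻¹ * deriv E6 z - 1 / 2 * E2 z * E6 z + 1 / 2 * E4 z ^ 2 := by
  have := (aux_eventuallyEq_E6 z.im_pos).deriv_eq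
  simp only [auxF, Pi.add_apply, Derivative.serreDerivative_apply, Pi.smul_apply, Pi.mul_apply,
    smul_eq_mul, Derivative.normalizedDerivOfComplex, aux_E2, aux_E4, aux_E6]
  erw [this]
  push_cast
  ring

lemma auxF_zero : UpperHalfPlane.IsZeroAtImInfty auxF := by
  have h := ((aux_lim_deriv.const_mul (2 * Real.pi * Complex.I)⁻¹).sub
    ((aux_lim_E2.const_mul (1 / 2)).mul aux_lim_E6)).add ((aux_lim_E4.pow 2).const_mul (1 / 2))
  refine (Filter.Tendsto.congr (fun z => (auxF_apply z).symm) h).trans ?_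
  norm_num

open scoped MatrixGroups ModularForm in
/-- `auxF` as a cusp form. -/
noncomputable def auxCusp : CuspForm 𝒮ℒ 8 where
  toFun := auxF
  slash_action_eq' A hA := by
    obtain ⟨A, rfl⟩ := hA
    exact auxF_slash A
  holo' := by
    refine (Derivative.serreDerivative_mdifferentiable _ ModularForm.E₆.holo').add ?_
    exact (ModularForm.E₄.holo'.mul ModularForm.E₄.holo').const_smul _
  zero_at_cusps' hc := by
    rw [Subgroup.IsArithmetic.isCusp_iff_isCusp_SL2Z] at hc
    rw [OnePoint.isZeroAt_iff_forall_SL2Z hc]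
    intro γ _
    rw [auxF_slash]
    exact auxF_zero

lemma aux_ramanujan {z : ℂ} (hz : 0 < z.im) :
    deriv E6 z = Real.pi * Complex.I * (E2 z * E6 z - E4 z ^ 2) := by
  have h1 := rank_zero_iff_forall_zero.mp
    (CuspForm.rank_eq_zero_of_weight_lt_twelve (k := 8) (by norm_num)) auxCusp
  have h2 : auxF ⟨z, hz⟩ = 0 := by
    have := congrArg (fun g => g ⟨z, hz⟩) h1
    exact this
  rw [auxF_apply] at h2
  simp only at h2
  have hp : (Real.pi : ℂ) ≠ 0 := by exact_mod_cast Real.pi_ne_zero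
  have hI := Complex.I_ne_zero
  field_simp at h2
  linear_combination h2

lemma aux_qq_line (b : ℝ) : qq ((1 / 2 : ℂ) + Complex.I * b) =
    ((-Real.exp (-(2 * Real.pi * b)) : ℝ) : ℂ) := by
  have : 2 * (Real.pi : ℂ) * Complex.I * ((1 / 2 : ℂ) + Complex.I * b) =
      Real.pi * Complex.I + ((-(2 * Real.pi * b) : ℝ) : ℂ) := by
    push_cast
    linear_combination (2 * (Real.pi : ℂ) * b) * Complex.I_mul_I
  rw [qq, this, Complex.exp_add, Complex.exp_pi_mul_I]
  push_cast
  ring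

lemma aux_real_tsum (k : ℕ) (b : ℝ) :
    ∑' n : ℕ, sigmaC k (n + 1) * qq ((1 / 2 : ℂ) + Complex.I * b) ^ (n + 1) =
    ((∑' n : ℕ, (ArithmeticFunction.sigma k (n + 1) : ℝ) *
      (-Real.exp (-(2 * Real.pi * b))) ^ (n + 1) : ℝ) : ℂ) := by
  rw [aux_qq_line, Complex.ofReal_tsum]
  simp [aux_sigmaC]

lemma aux_real_E2 (b : ℝ) : ∃ r : ℝ, E2 ((1 / 2 : ℂ) + Complex.I * b) = r := by
  rw [E2, aux_real_tsum]
  generalize (∑' n : ℕ, _ : ℝ) = s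
  exact ⟨1 - 24 * s, by push_cast; rfl⟩
lemma aux_real_E4 (b : ℝ) : ∃ r : ℝ, E4 ((1 / 2 : ℂ) + Complex.I * b) = r := by
  rw [E4, aux_real_tsum]
  generalize (∑' n : ℕ, _ : ℝ) = s
  exact ⟨1 + 240 * s, by push_cast; rfl⟩
lemma aux_real_E6 (b : ℝ) : ∃ r : ℝ, E6 ((1 / 2 : ℂ) + Complex.I * b) = r := by
  rw [E6, aux_real_tsum]
  generalize (∑' n : ℕ, _ : ℝ) = s
  exact ⟨1 - 504 * s, by push_cast; rfl⟩

/-- The value at `(1+i)/2`. -/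
lemma aux_left_E6 : E6 ((1 / 2 : ℂ) + Complex.I * ((1 / 2 : ℝ) : ℂ)) = 0 := by
  have h1 := aux_E6_S UpperHalfPlane.I
  have hI : E6 Complex.I = 0 := by
    rw [UpperHalfPlane.coe_I, show (-1 / Complex.I : ℂ) = Complex.I by
      rw [div_eq_iff Complex.I_ne_zero, Complex.I_mul_I]] at h1
    have h6 : Complex.I ^ 6 = -1 := by
      rw [show Complex.I ^ 6 = (Complex.I * Complex.I) ^ 3 by ring, Complex.I_mul_I]; norm_num
    rw [h6] at h1
    linear_combination h1 / 2
  have h2 : E6 (Complex.I - 1) = 0 := by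
    rw [← aux_E6_T, sub_add_cancel, hI]
  have h3 := aux_E6_S ⟨Complex.I - 1, by simp⟩
  simp only [h2, mul_zero] at h3
  rw [← h3]
  congr 1
  have hne : Complex.I - 1 ≠ 0 := by
    intro h
    simpa using congrArg Complex.im h
  rw [eq_div_iff hne]
  push_cast
  linear_combination (1 / 2 : ℂ) * Complex.I_mul_I

lemma aux_rho_ne {b : ℝ} (hb : 0 < b) : (1 / 2 : ℂ) + Complex.I * b ≠ 0 := by
  intro h
  have := congrArg Complex.im h
  simp at this
  exact hb.ne' this

lemma aux_rho_im {b : ℝ} (hb : 0 < b) : 0 < ((1 / 2 : ℂ) + Complex.I * b).im := by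
  simpa using hb

lemma aux_right : E4 ((1 / 2 : ℂ) + Complex.I * ((Real.sqrt 3 / 2 : ℝ) : ℂ)) = 0 ∧
    E2 ((1 / 2 : ℂ) + Complex.I * ((Real.sqrt 3 / 2 : ℝ) : ℂ)) =
      ((2 * Real.sqrt 3 / Real.pi : ℝ) : ℂ) := by
  have hs : (0 : ℝ) < Real.sqrt 3 / 2 := by positivity
  have hne := aux_rho_ne hs
  have him := aux_rho_im hs
  have hsq : ((Real.sqrt 3 : ℝ) : ℂ) ^ 2 = 3 := by
    exact_mod_cast Real.sq_sqrt (by norm_num : (0 : ℝ) ≤ 3)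
  set ρ : ℂ := (1 / 2 : ℂ) + Complex.I * ((Real.sqrt 3 / 2 : ℝ) : ℂ) with hρ
  have hI2 := Complex.I_mul_I
  have hρ2 : ρ ^ 2 = ρ - 1 := by
    rw [hρ]; push_cast
    linear_combination ((Real.sqrt 3 : ℂ) ^ 2 / 4) * hI2 - hsq / 4
  have hS : -1 / ρ = ρ - 1 := by
    rw [div_eq_iff hne]; linear_combination -hρ2
  have h4 := aux_E4_S ⟨ρ, him⟩
  have h2 := aux_E2_S ⟨ρ, him⟩
  simp only [hS] at h4 h2
  have e4 : E4 (ρ - 1) = E4 ρ := by rw [← aux_E4_T, sub_add_cancel]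
  have e2 : E2 (ρ - 1) = E2 ρ := by rw [← aux_E2_T, sub_add_cancel]
  rw [e4] at h4
  rw [e2] at h2
  have hp : (Real.pi : ℂ) ≠ 0 := by exact_mod_cast Real.pi_ne_zero
  have hρ3 : ρ ^ 3 = -1 := by linear_combination (ρ + 1) * hρ2
  constructor
  · have : (1 + ρ) * E4 ρ = 0 := by linear_combination h4 + ρ * E4 ρ * hρ3
    rcases mul_eq_zero.mp this with h | h
    · exfalso
      have := congrArg Complex.re h
      norm_num [hρ] at this
    · exact h
  · have hk : (ρ ^ 2 - 1) * E2 ρ * Real.pi = 6 * Complex.I * ρ := by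
      field_simp at h2
      linear_combination h2
    have hne2 : ρ - 2 ≠ 0 := by
      intro h
      have := congrArg Complex.re h
      norm_num [hρ] at this
    push_cast
    rw [eq_div_iff hp]
    apply mul_left_cancel₀ hne2
    have h5 : (ρ - 2) * (2 * (Real.sqrt 3 : ℂ)) = 6 * Complex.I * ρ := by
      rw [hρ]; push_cast
      linear_combination Complex.I * hsq - 3 * (Real.sqrt 3 : ℂ) * hI2
    rw [h5, ← hk, hρ2]
    ring

lemma aux_exp_small : Real.exp (-(2 * Real.pi * (Real.sqrt 3 / 2))) ≤ 1 / 100 := by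
  have h3 : (1.7 : ℝ) ≤ Real.sqrt 3 := Real.le_sqrt_of_sq_le (by norm_num)
  have hp := Real.pi_gt_d2
  have h5 : -(2 * Real.pi * (Real.sqrt 3 / 2)) ≤ -5 := by nlinarith
  refine (Real.exp_le_exp.mpr h5).trans ?_
  rw [Real.exp_neg, show (1 / 100 : ℝ) = (100)⁻¹ by norm_num]
  apply inv_anti₀ (by norm_num)
  have h1 := Real.exp_one_gt_d9
  have : Real.exp 5 = Real.exp 1 ^ 5 := by rw [← Real.exp_nat_mul]; norm_num
  rw [this]
  calc (100 : ℝ) ≤ (2.7 : ℝ) ^ 5 := by norm_num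
    _ ≤ _ := by gcongr; linarith

lemma aux_pow_le (m : ℕ) : ((m : ℝ) + 2) ^ 6 ≤ 64 * 12 ^ m := by
  induction m with
  | zero => norm_num
  | succ m ih =>
    have h : ((m + 1 : ℕ) : ℝ) + 2 ≤ (3 / 2) * ((m : ℝ) + 2) := by
      have : (0 : ℝ) ≤ m := by positivity
      push_cast; linarith
    calc (((m + 1 : ℕ) : ℝ) + 2) ^ 6 ≤ ((3 / 2) * ((m : ℝ) + 2)) ^ 6 := by gcongr
      _ = (3 / 2) ^ 6 * ((m : ℝ) + 2) ^ 6 := by ring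
      _ ≤ 12 * (64 * 12 ^ m) := by gcongr; norm_num
      _ = _ := by ring

/-- positivity of `1 - 504 ∑ σ₅(n) (-r)^n` for small `r`. -/
lemma aux_pos {r : ℝ} (h0 : 0 < r) (h1 : r ≤ 1 / 100) :
    0 < 1 - 504 * ∑' n : ℕ, (ArithmeticFunction.sigma 5 (n + 1) : ℝ) * (-r) ^ (n + 1) := by
  have hb : ∀ n : ℕ, ‖(ArithmeticFunction.sigma 5 (n + 1 + 1) : ℝ) * (-r) ^ (n + 1 + 1)‖ ≤
      64 * r ^ 2 * (12 * r) ^ n := by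
    intro n
    have hs : (ArithmeticFunction.sigma 5 (n + 1 + 1) : ℝ) ≤ ((n : ℝ) + 2) ^ 6 := by
      have := ArithmeticFunction.sigma_le_pow_succ 5 (n + 1 + 1)
      have h2 : (ArithmeticFunction.sigma 5 (n + 1 + 1) : ℝ) ≤ ((n + 1 + 1 : ℕ) : ℝ) ^ 6 := by
        exact_mod_cast this
      refine h2.trans (le_of_eq ?_)
      push_cast; ring
    rw [norm_mul, norm_pow, norm_neg, Real.norm_of_nonneg h0.le, Real.norm_of_nonneg (by positivity)]
    calc _ ≤ (64 * 12 ^ n) * r ^ (n + 1 + 1) := by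
          gcongr; exact hs.trans (aux_pow_le n)
      _ = _ := by rw [mul_pow]; ring
  have hg : HasSum (fun n : ℕ => 64 * r ^ 2 * (12 * r) ^ n) (64 * r ^ 2 * (1 - 12 * r)⁻¹) :=
    (hasSum_geometric_of_lt_one (by positivity) (by linarith)).mul_left _
  have hsum : Summable fun n : ℕ =>
      (ArithmeticFunction.sigma 5 (n + 1 + 1) : ℝ) * (-r) ^ (n + 1 + 1) :=
    Summable.of_norm_bounded hg.summable hb
  have hsum' : Summable fun n : ℕ =>
      (ArithmeticFunction.sigma 5 (n + 1) : ℝ) * (-r) ^ (n + 1) :=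
    (summable_nat_add_iff (f := fun n : ℕ =>
      (ArithmeticFunction.sigma 5 (n + 1) : ℝ) * (-r) ^ (n + 1)) 1).mp hsum
  rw [hsum'.tsum_eq_zero_add]
  have ht := tsum_of_norm_bounded hg hb
  have hle : 64 * r ^ 2 * (1 - 12 * r)⁻¹ ≤ r := by
    rw [← div_eq_mul_inv, div_le_iff₀ (by linarith)]
    nlinarith
  have h3 := (le_abs_self _).trans (ht.trans hle)
  have h4 : (ArithmeticFunction.sigma 5 (0 + 1) : ℝ) * (-r) ^ (0 + 1) = -r := by simp
  rw [h4]
  linarith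

lemma aux_right_E6 : ∃ r : ℝ, 0 < r ∧
    E6 ((1 / 2 : ℂ) + Complex.I * ((Real.sqrt 3 / 2 : ℝ) : ℂ)) = r := by
  refine ⟨_, aux_pos (Real.exp_pos _) aux_exp_small, ?_⟩
  rw [E6, aux_real_tsum]
  push_cast
  rfl

theorem exists_zero_on_segment :
    ∃ b : ℝ, 1 / 2 < b ∧ b < Real.sqrt 3 / 2 ∧
      g2 ((1 / 2 : ℂ) + Complex.I * b) ^ 2 -
          18 * eta1 ((1 / 2 : ℂ) + Complex.I * b) * g3 ((1 / 2 : ℂ) + Complex.I * b) = 0 ∧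
      deriv g3 ((1 / 2 : ℂ) + Complex.I * b) = 0 := by
  set L : ℝ → ℂ := fun b => (1 / 2 : ℂ) + Complex.I * b with hL
  set φ : ℝ → ℝ := fun b => (E4 (L b) ^ 2 - E2 (L b) * E6 (L b)).re with hφ
  have hLc : Continuous L := by fun_prop
  have hs3 : (1.7 : ℝ) ≤ Real.sqrt 3 := Real.le_sqrt_of_sq_le (by norm_num)
  have hcont : ContinuousOn φ (Set.Icc (1 / 2) (Real.sqrt 3 / 2)) := by
    intro b hb
    have him : 0 < (L b).im := aux_rho_im (by linarith [hb.1])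
    have h2 := (aux_diff_E2 him).continuousAt.comp hLc.continuousAt
    have h4 := (aux_diff_E4 him).continuousAt.comp hLc.continuousAt
    have h6 := (aux_diff_E6 him).continuousAt.comp hLc.continuousAt
    exact (Complex.continuous_re.continuousAt.comp
      ((h4.pow 2).sub (h2.mul h6))).continuousWithinAt
  have hleft : 0 < φ (1 / 2) := by
    obtain ⟨r, hr⟩ := aux_real_E4 (1 / 2)
    have hd := aux_disc ⟨_, aux_rho_im (b := 1 / 2) (by norm_num)⟩
    simp only [aux_left_E6, hr] at hd
    have hr0 : r ≠ 0 := by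
      rintro rfl
      simp at hd
    simp only [hφ, hL, aux_left_E6, hr]
    have : 0 < r ^ 2 := by positivity
    rw [mul_zero, sub_zero, ← Complex.ofReal_pow, Complex.ofReal_re]
    exact this
  have hright : φ (Real.sqrt 3 / 2) < 0 := by
    obtain ⟨r, hr0, hr⟩ := aux_right_E6
    simp only [hφ, hL, aux_right.1, aux_right.2, hr]
    have : 0 < 2 * Real.sqrt 3 / Real.pi * r := by positivity
    rw [← Complex.ofReal_mul]
    simpa [-Complex.ofReal_mul] using this
  obtain ⟨b, hb, hb0⟩ := intermediate_value_Ioo' (by linarith) hcont ⟨hright, hleft⟩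
  have hz : E4 (L b) ^ 2 - E2 (L b) * E6 (L b) = 0 := by
    obtain ⟨r2, h2⟩ := aux_real_E2 b
    obtain ⟨r4, h4⟩ := aux_real_E4 b
    obtain ⟨r6, h6⟩ := aux_real_E6 b
    simp only [hφ, hL, h2, h4, h6] at hb0 ⊢
    norm_cast at hb0 ⊢
  have him : 0 < (L b).im := aux_rho_im (by linarith [hb.1])
  refine ⟨b, hb.1, hb.2, ?_, ?_⟩
  · change g2 (L b) ^ 2 - 18 * eta1 (L b) * g3 (L b) = 0
    simp only [g2, g3, eta1]
    linear_combination (16 * (Real.pi : ℂ) ^ 8 / 9) * hz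
  · change deriv g3 (L b) = 0
    have : g3 = fun τ => (8 * (Real.pi : ℂ) ^ 6 / 27) * E6 τ := rfl
    rw [this, deriv_const_mul _ (aux_diff_E6 him), aux_ramanujan him]
    linear_combination (-(8 * (Real.pi : ℂ) ^ 6 / 27) * Real.pi * Complex.I) * hz
end
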